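/- arXiv:2410.02495 — 2 statements merged into one kernel-verified Lean document; each statement's English description precedes it below -/
import Mathlib

section
/- Let (R,μ) be any measure space with μ(R) < ∞ (non-atomicity is not needed), let A be a Young function, and let 1 ≤ q < p < ∞. If ∫_c^∞ (t^p / A(t))^{q/(p−q)} dt/t < ∞ for some c > 0, then the almost-compact embedding L^A ↪* L^{p,q} holds. -/
open MeasureTheory Filter Set ENNReal

noncomputable section

/-- A Young function: a convex, non-decreasing, left-continuous function
`A : [0,∞] → [0,∞]` with `A(0) = 0`, `A(0+) = 0` and `A(∞) = ∞`. -/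
structure YoungFunction where
  toFun : ℝ≥0∞ → ℝ≥0∞
  map_zero : toFun 0 = 0
  tendsto_zero : Filter.Tendsto toFun (nhdsWithin 0 (Set.Ioi 0)) (nhds 0)
  mono : Monotone toFun
  convex' : ∀ s t c : ℝ≥0∞, c ≤ 1 →
    toFun (c * s + (1 - c) * t) ≤ c * toFun s + (1 - c) * toFun t
  left_continuous : ∀ t : ℝ≥0∞, 0 < t → toFun t = ⨆ s ∈ Set.Iio t, toFun s
  map_top : toFun ⊤ = ⊤

/-- Left-continuous inverse of a non-decreasing function `F : [0,∞] → [0,∞]`: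
`F⁻¹(t) = inf {τ ≥ 0 : F(τ) ≥ t}`. -/
def leftInvE (F : ℝ≥0∞ → ℝ≥0∞) (t : ℝ≥0∞) : ℝ≥0∞ :=
  sInf {τ : ℝ≥0∞ | t ≤ F τ}

/-- `a` is the right-continuous derivative of the Young function `A`:
`a` is non-decreasing, right-continuous, `a(∞) = ∞`, and
`A(t) = ∫₀ᵗ a(s) ds` for all finite `t ≥ 0`. -/
def IsYoungDerivative (A : YoungFunction) (a : ℝ≥0∞ → ℝ≥0∞) : Prop :=
  Monotone a ∧ a ⊤ = ⊤ ∧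
    (∀ t : ℝ≥0∞, t ≠ ⊤ → Filter.Tendsto a (nhdsWithin t (Set.Ioi t)) (nhds (a t))) ∧
    ∀ t : ℝ, 0 ≤ t →
      A.toFun (ENNReal.ofReal t) = ∫⁻ s in Set.Ioc (0:ℝ) t, a (ENNReal.ofReal s)

/-- The Young conjugate `B̃(t) = sup {s·t − B(s) : s ∈ [0,∞]}`. -/
def youngConj (A : YoungFunction) (t : ℝ≥0∞) : ℝ≥0∞ :=
  ⨆ s : ℝ≥0∞, s * t - A.toFun s

variable {R : Type*} [MeasurableSpace R]

/-- The distribution function `f₊(λ) = μ({x : |f(x)| > λ})`. -/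
def distFn (μ : Measure R) (f : R → ℝ) (lam : ℝ≥0∞) : ℝ≥0∞ :=
  μ {x | lam < ENNReal.ofReal |f x|}

/-- The non-increasing rearrangement `f*(t) = inf {λ ≥ 0 : f₊(λ) ≤ t}`. -/
def rearr (μ : Measure R) (f : R → ℝ) (t : ℝ≥0∞) : ℝ≥0∞ :=
  sInf {lam : ℝ≥0∞ | distFn μ f lam ≤ t}

/-- The Lorentz functional `‖f‖_{p,q}` for `p, q ∈ (0,∞]`. -/
def lorentzNorm (μ : Measure R) (p q : ℝ≥0∞) (f : R → ℝ) : ℝ≥0∞ :=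
  if q = ⊤ then
    ⨆ t : Set.Ioi (0:ℝ), ENNReal.ofReal t.1 ^ (p⁻¹).toReal * rearr μ f (ENNReal.ofReal t.1)
  else
    (∫⁻ t in Set.Ioi (0:ℝ),
        (ENNReal.ofReal t ^ (p⁻¹).toReal * rearr μ f (ENNReal.ofReal t)) ^ q.toReal
          / ENNReal.ofReal t) ^ (q⁻¹).toReal

/-- The Luxemburg norm `‖f‖_A = inf {λ > 0 : ∫ A(|f|/λ) dμ ≤ 1}`. -/
def luxNorm (μ : Measure R) (A : YoungFunction) (f : R → ℝ) : ℝ≥0∞ :=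
  sInf {lam : ℝ≥0∞ | 0 < lam ∧ ∫⁻ x, A.toFun (ENNReal.ofReal |f x| / lam) ∂μ ≤ 1}

/-- The measure `μ` is non-atomic: every set of positive measure has a subset
of strictly smaller positive measure. -/
def NonAtomic (μ : Measure R) : Prop :=
  ∀ s : Set R, MeasurableSet s → 0 < μ s →
    ∃ t, t ⊆ s ∧ MeasurableSet t ∧ 0 < μ t ∧ μ t < μ s

/-- The almost-compact embedding `X ↪* Y`, for (quasi)norm functionals `NX`, `NY`:
`X ⊂ Y` and for every sequence of measurable sets `Eₙ` whose characteristic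
functions tend to `0` a.e., `sup_{‖f‖_X ≤ 1} ‖f χ_{Eₙ}‖_Y → 0`. -/
def AlmostCompactEmbedding (μ : Measure R) (NX NY : (R → ℝ) → ℝ≥0∞) : Prop :=
  (∀ f : R → ℝ, Measurable f → NX f < ⊤ → NY f < ⊤) ∧
    ∀ E : ℕ → Set R, (∀ n, MeasurableSet (E n)) →
      (∀ᵐ x ∂μ, Filter.Tendsto (fun n => (E n).indicator (fun _ => (1:ℝ)) x)
        Filter.atTop (nhds 0)) →
      Filter.Tendsto
        (fun n => ⨆ f : {f : R → ℝ // Measurable f ∧ NX f ≤ 1},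
          NY ((E n).indicator f.1)) Filter.atTop (nhds 0)

/-- The continuous embedding `X ↪ Y`: there is `C > 0` with `‖f‖_Y ≤ C ‖f‖_X`. -/
def NormEmbedding (μ : Measure R) (NX NY : (R → ℝ) → ℝ≥0∞) : Prop :=
  ∃ C : ℝ, 0 < C ∧ ∀ f : R → ℝ, Measurable f → NY f ≤ ENNReal.ofReal C * NX f
theorem setLIntegral_Ioo_rpow_sub_one {r s : ℝ} (hr : 0 < r) (hs : 0 ≤ s) :
    ∫⁻ l in Set.Ioo 0 s, ENNReal.ofReal l ^ (r - 1) = ENNReal.ofReal s ^ r / ENNReal.ofReal r := by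
  have hint : IntervalIntegrable (fun x : ℝ => x ^ (r - 1)) volume 0 s :=
    intervalIntegral.intervalIntegrable_rpow' (by linarith)
  rw [intervalIntegrable_iff_integrableOn_Ioo_of_le hs] at hint
  have hval : ∫ x in Set.Ioo 0 s, x ^ (r - 1) = s ^ r / r := by
    rw [← integral_Ioc_eq_integral_Ioo, ← intervalIntegral.integral_of_le hs,
      integral_rpow (Or.inl (by linarith)), sub_add_cancel, Real.zero_rpow hr.ne', sub_zero]
  rw [ENNReal.ofReal_rpow_of_nonneg hs hr.le, ← ENNReal.ofReal_div_of_pos hr, ← hval,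
    ofReal_integral_eq_lintegral_ofReal hint]
  · refine setLIntegral_congr_fun measurableSet_Ioo fun x hx => ?_
    exact ENNReal.ofReal_rpow_of_pos hx.1
  · refine (ae_restrict_iff' measurableSet_Ioo).2 (ae_of_all _ fun x hx => ?_)
    exact Real.rpow_nonneg hx.1.le _

theorem setLIntegral_Ioi_indicator_rpow_sub_one {r : ℝ} (hr : 0 < r) (x : ℝ≥0∞) :
    ∫⁻ l in Set.Ioi (0 : ℝ),
      {l : ℝ | ENNReal.ofReal l < x}.indicator (fun l => ENNReal.ofReal l ^ (r - 1)) l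
      = x ^ r / ENNReal.ofReal r := by
  have hmeas : ∀ y : ℝ≥0∞, MeasurableSet {l : ℝ | ENNReal.ofReal l < y} := fun y =>
    measurableSet_lt ENNReal.measurable_ofReal measurable_const
  have hreal : ∀ s : ℝ, 0 ≤ s → ∫⁻ l in Set.Ioi (0 : ℝ),
      {l : ℝ | ENNReal.ofReal l < ENNReal.ofReal s}.indicator
        (fun l => ENNReal.ofReal l ^ (r - 1)) l
      = ENNReal.ofReal s ^ r / ENNReal.ofReal r := by
    intro s hs
    rw [setLIntegral_indicator (hmeas _), ← setLIntegral_Ioo_rpow_sub_one hr hs]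
    congr 2
    ext l
    simp only [Set.mem_inter_iff, Set.mem_ofPred_eq, Set.mem_Ioi, Set.mem_Ioo]
    constructor
    · rintro ⟨h1, h2⟩
      exact ⟨h2, (ENNReal.ofReal_lt_ofReal_iff_of_nonneg h2.le).1 h1⟩
    · rintro ⟨h1, h2⟩
      exact ⟨(ENNReal.ofReal_lt_ofReal_iff_of_nonneg h1.le).2 h2, h1⟩
  rcases eq_or_ne x ⊤ with rfl | hx
  · have hlim : Filter.Tendsto (fun n : ℕ => ENNReal.ofReal (n : ℝ) ^ r / ENNReal.ofReal r)
        Filter.atTop (nhds (⊤ ^ r / ENNReal.ofReal r)) := by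
      simp only [ENNReal.ofReal_natCast]
      refine ENNReal.Tendsto.div_const ?_ (Or.inl ?_)
      · exact (ENNReal.continuous_rpow_const.tendsto _).comp ENNReal.tendsto_nat_nhds_top
      · simp [hr]
    have htop : (⊤ : ℝ≥0∞) ^ r / ENNReal.ofReal r = ⊤ := by
      rw [ENNReal.top_rpow_of_pos hr, ENNReal.top_div_of_ne_top ENNReal.ofReal_ne_top]
    refine le_antisymm (le_top.trans_eq htop.symm) (le_of_tendsto' hlim fun n => ?_)
    rw [← hreal n n.cast_nonneg]
    refine lintegral_mono fun l => ?_
    exact Set.indicator_le_indicator_of_subset (fun l _ => ENNReal.ofReal_lt_top)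
      (fun _ => zero_le) l
  · rw [← ENNReal.ofReal_toReal hx]
    exact hreal _ ENNReal.toReal_nonneg

theorem distFn_antitone (μ : Measure R) (f : R → ℝ) : Antitone (distFn μ f) :=
  fun _ _ h => measure_mono fun _ hx => lt_of_le_of_lt h hx

theorem lt_distFn_of_lt_rearr {μ : Measure R} {f : R → ℝ} {t l : ℝ≥0∞}
    (h : l < rearr μ f t) : t < distFn μ f l := by
  by_contra! hle
  exact h.not_ge (sInf_le hle)

theorem lorentzNorm_ofReal_le (μ : Measure R) (f : R → ℝ) {p q : ℝ} (hp : 0 < p) (hq : 0 < q) :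
    lorentzNorm μ (ENNReal.ofReal p) (ENNReal.ofReal q) f ≤
      (ENNReal.ofReal p * ∫⁻ l in Set.Ioi (0 : ℝ),
        ENNReal.ofReal l ^ (q - 1) * distFn μ f (ENNReal.ofReal l) ^ (q / p)) ^ q⁻¹ := by
  have hqp : 0 < q / p := by positivity
  rw [lorentzNorm, if_neg ENNReal.ofReal_ne_top, ENNReal.toReal_inv, ENNReal.toReal_inv,
    ENNReal.toReal_ofReal hp.le, ENNReal.toReal_ofReal hq.le]
  refine ENNReal.rpow_le_rpow ?_ (by positivity)
  set d : ℝ → ℝ≥0∞ := fun l => distFn μ f (ENNReal.ofReal l)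
  have hd : Measurable d := (distFn_antitone μ f).measurable.comp ENNReal.measurable_ofReal
  set K : ℝ → ℝ → ℝ≥0∞ := fun t l =>
    {z : ℝ × ℝ | ENNReal.ofReal z.1 < d z.2}.indicator
      (fun z => ENNReal.ofReal z.1 ^ (q / p - 1) * ENNReal.ofReal z.2 ^ (q - 1)) (t, l)
  have hK : Measurable (Function.uncurry K) := by
    refine Measurable.indicator (by fun_prop) (measurableSet_lt (by fun_prop) (by fun_prop))
  calc _ ≤ ∫⁻ t in Set.Ioi (0 : ℝ), ENNReal.ofReal q * ∫⁻ l in Set.Ioi (0 : ℝ), K t l := by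
        refine setLIntegral_mono' measurableSet_Ioi fun t ht => ?_
        have ht : 0 < t := ht
        have ht0 : ENNReal.ofReal t ≠ 0 := by simpa using ht
        set x := rearr μ f (ENNReal.ofReal t)
        have hx : x ^ q = ENNReal.ofReal q * ∫⁻ l in Set.Ioi (0 : ℝ),
            {l : ℝ | ENNReal.ofReal l < x}.indicator (fun l => ENNReal.ofReal l ^ (q - 1)) l := by
          rw [setLIntegral_Ioi_indicator_rpow_sub_one hq,
            ENNReal.mul_div_cancel (by simpa using hq) ENNReal.ofReal_ne_top]
        rw [ENNReal.mul_rpow_of_nonneg _ _ hq.le, ← ENNReal.rpow_mul, ← div_eq_inv_mul,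
          mul_comm, mul_div_assoc,
          show ENNReal.ofReal t ^ (q / p) / ENNReal.ofReal t = ENNReal.ofReal t ^ (q / p - 1) by
            rw [ENNReal.rpow_sub _ _ ht0 ENNReal.ofReal_ne_top, ENNReal.rpow_one],
          hx, mul_assoc, ← lintegral_mul_const _ (Measurable.indicator (by fun_prop)
            (measurableSet_lt ENNReal.measurable_ofReal measurable_const))]
        gcongr with l
        by_cases hl : ENNReal.ofReal l < x
        · have h1 : (t, l) ∈ {z : ℝ × ℝ | ENNReal.ofReal z.1 < d z.2} := lt_distFn_of_lt_rearr hl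
          simp only [K]
          rw [Set.indicator_of_mem h1, Set.indicator_of_mem (by exact hl), mul_comm]
        · rw [Set.indicator_of_notMem (by exact hl), zero_mul]
          exact zero_le
    _ = ENNReal.ofReal q * ∫⁻ l in Set.Ioi (0 : ℝ), ∫⁻ t in Set.Ioi (0 : ℝ), K t l := by
        have hK' : Measurable fun t => ∫⁻ l in Set.Ioi (0 : ℝ), K t l := hK.lintegral_prod_right'
        rw [lintegral_const_mul _ hK', lintegral_lintegral_swap hK.aemeasurable]
    _ = ENNReal.ofReal q * ∫⁻ l in Set.Ioi (0 : ℝ),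
          ENNReal.ofReal l ^ (q - 1) * (d l ^ (q / p) / ENNReal.ofReal (q / p)) := by
        congr 1
        refine lintegral_congr fun l => ?_
        rw [← setLIntegral_Ioi_indicator_rpow_sub_one hqp, ← lintegral_const_mul _
          (Measurable.indicator (by fun_prop)
            (measurableSet_lt ENNReal.measurable_ofReal measurable_const))]
        refine lintegral_congr fun t => ?_
        simp only [K, Set.indicator_apply, Set.mem_ofPred_eq]
        split_ifs
        · rw [mul_comm]
        · rw [mul_zero]
    _ = _ := by
        simp only [div_eq_mul_inv _ (ENNReal.ofReal (q / p)), ← mul_assoc]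
        rw [lintegral_mul_const _ (by fun_prop), mul_comm, mul_assoc, mul_comm]
        congr 1
        rw [← ENNReal.ofReal_inv_of_pos hqp, ← ENNReal.ofReal_mul (by positivity)]
        congr 1
        field_simp

theorem YoungFunction.div_le_div (A : YoungFunction) {l s : ℝ≥0∞} (hl : l ≠ 0) (hls : l ≤ s)
    (hs : s ≠ ⊤) : A.toFun l / l ≤ A.toFun s / s := by
  have hs0 : s ≠ 0 := fun h => hl (le_zero_iff.1 (h ▸ hls))
  have h := A.convex' s 0 (l / s) (ENNReal.div_le_of_le_mul (by simpa using hls))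
  rw [ENNReal.div_mul_cancel hs0 hs, A.map_zero, mul_zero, add_zero, add_zero] at h
  refine ENNReal.div_le_of_le_mul (h.trans_eq ?_)
  simp only [div_eq_mul_inv]
  ring

theorem lintegral_div_mul_distFn_le (μ : Measure R) [SFinite μ] (A : YoungFunction) {f : R → ℝ}
    (hf : Measurable f) :
    ∫⁻ l in Set.Ioi (0 : ℝ), A.toFun (ENNReal.ofReal l) / ENNReal.ofReal l *
      distFn μ f (ENNReal.ofReal l) ≤ ∫⁻ x, A.toFun (ENNReal.ofReal |f x|) ∂μ := by
  have hA : Measurable A.toFun := A.mono.measurable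
  set a : ℝ → ℝ≥0∞ := fun l => A.toFun (ENNReal.ofReal l) / ENNReal.ofReal l
  have ha : Measurable a := by fun_prop
  set K : ℝ → R → ℝ≥0∞ := fun l x =>
    {z : ℝ × R | ENNReal.ofReal z.1 < ENNReal.ofReal |f z.2|}.indicator (fun z => a z.1) (l, x)
  have hK : Measurable (Function.uncurry K) := by
    refine Measurable.indicator (by fun_prop) (measurableSet_lt (by fun_prop) ?_)
    exact ENNReal.measurable_ofReal.comp ((hf.comp measurable_snd).abs)
  calc _ = ∫⁻ l in Set.Ioi (0 : ℝ), ∫⁻ x, K l x ∂μ := by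
        refine lintegral_congr fun l => ?_
        have hset : MeasurableSet {x | ENNReal.ofReal l < ENNReal.ofReal |f x|} :=
          measurableSet_lt measurable_const (ENNReal.measurable_ofReal.comp hf.abs)
        rw [distFn, ← lintegral_indicator_const hset]
        rfl
    _ = ∫⁻ x, (∫⁻ l in Set.Ioi (0 : ℝ), K l x) ∂μ := lintegral_lintegral_swap hK.aemeasurable
    _ ≤ _ := by
        refine lintegral_mono fun x => ?_
        set s := |f x|
        calc _ ≤ ∫⁻ l in Set.Ioi (0 : ℝ), (Set.Ioo 0 s).indicator (fun _ => a s) l := by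
              refine setLIntegral_mono' measurableSet_Ioi fun l (hl : 0 < l) => ?_
              simp only [K, Set.indicator_apply, Set.mem_ofPred_eq,
                ENNReal.ofReal_lt_ofReal_iff_of_nonneg hl.le, Set.mem_Ioo, hl, true_and]
              change (if l < s then _ else _) ≤ _
              split_ifs with h
              · exact A.div_le_div (by simpa using hl) (ENNReal.ofReal_le_ofReal h.le)
                  ENNReal.ofReal_ne_top
              · exact le_rfl
          _ ≤ ∫⁻ l, (Set.Ioo 0 s).indicator (fun _ => a s) l := setLIntegral_le_lintegral _ _
          _ = a s * ENNReal.ofReal s := by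
              rw [lintegral_indicator_const measurableSet_Ioo, Real.volume_Ioo, sub_zero]
          _ ≤ _ := ENNReal.mul_le_of_le_div le_rfl

theorem distFn_mul_le (μ : Measure R) (A : YoungFunction) {f : R → ℝ} (hf : Measurable f)
    (l : ℝ≥0∞) : A.toFun l * distFn μ f l ≤ ∫⁻ x, A.toFun (ENNReal.ofReal |f x|) ∂μ := by
  have hA : Measurable A.toFun := A.mono.measurable
  refine le_trans ?_ (mul_meas_ge_le_lintegral
    (hA.comp (ENNReal.measurable_ofReal.comp hf.abs)) (A.toFun l))
  exact mul_le_mul_right (measure_mono fun x hx => A.mono (le_of_lt hx)) _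

theorem setLIntegral_rpow_mul_distFn_le (μ : Measure R) [SFinite μ] (A : YoungFunction)
    {f : R → ℝ} (hf : Measurable f) (hA1 : ∫⁻ x, A.toFun (ENNReal.ofReal |f x|) ∂μ ≤ 1)
    {p q : ℝ} (hq : 0 < q) (hqp : q < p) {t : ℝ} (ht : 0 ≤ t)
    (hA0 : ∀ᵐ l ∂volume.restrict (Set.Ioi t), A.toFun (ENNReal.ofReal l) ≠ 0) :
    ∫⁻ l in Set.Ioi t, ENNReal.ofReal l ^ (q - 1) * distFn μ f (ENNReal.ofReal l) ^ (q / p) ≤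
      (∫⁻ l in Set.Ioi t, (ENNReal.ofReal l ^ p / A.toFun (ENNReal.ofReal l)) ^ (q / (p - q))
        / ENNReal.ofReal l) ^ ((p - q) / p) := by
  have hp : 0 < p := hq.trans hqp
  have hpq : 0 < p - q := sub_pos.2 hqp
  have hA : Measurable A.toFun := A.mono.measurable
  set d : ℝ → ℝ≥0∞ := fun l => distFn μ f (ENNReal.ofReal l)
  have hd : Measurable d := (distFn_antitone μ f).measurable.comp ENNReal.measurable_ofReal
  set X : ℝ → ℝ≥0∞ := fun l =>
    (ENNReal.ofReal l ^ p / A.toFun (ENNReal.ofReal l)) ^ (q / (p - q)) / ENNReal.ofReal l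
  have hX : Measurable X := by fun_prop
  set Y : ℝ → ℝ≥0∞ := fun l => A.toFun (ENNReal.ofReal l) / ENNReal.ofReal l * d l
  have hY : Measurable Y := by fun_prop
  have hconj : (p / (p - q)).HolderConjugate (p / q) :=
    ⟨by field_simp; ring, by positivity, by positivity⟩
  calc _ ≤ ∫⁻ l in Set.Ioi t, ((fun l => X l ^ ((p - q) / p)) * fun l => Y l ^ (q / p)) l := by
        refine lintegral_mono_ae ?_
        filter_upwards [hA0, ae_restrict_mem measurableSet_Ioi] with l hl0 hl
        have hlpos : 0 < l := ht.trans_lt hl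
        simp only [Pi.mul_apply, X, Y, d]
        set y := ENNReal.ofReal l
        have hy0 : y ≠ 0 := by simpa [y] using hlpos
        have hyt : y ≠ ⊤ := ENNReal.ofReal_ne_top
        rcases eq_or_ne (A.toFun y) ⊤ with htop | htop
        · have hd0 : distFn μ f y = 0 := by
            by_contra h0
            have := (distFn_mul_le μ A hf y).trans hA1
            rw [htop, ENNReal.top_mul h0] at this
            simp at this
          rw [hd0, ENNReal.zero_rpow_of_pos (div_pos hq hp), mul_zero]
          exact zero_le
        · refine le_of_eq ?_
          have e1 : q / (p - q) * ((p - q) / p) = q / p := by field_simp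
          rw [div_eq_mul_inv _ y, ENNReal.mul_rpow_of_nonneg _ _ (by positivity),
            ← ENNReal.rpow_mul, e1, ENNReal.mul_rpow_of_nonneg _ _ (by positivity),
            div_eq_mul_inv _ y]
          have e2 : (y ^ p / A.toFun y) ^ (q / p) * A.toFun y ^ (q / p) = y ^ q := by
            rw [← ENNReal.mul_rpow_of_nonneg _ _ (by positivity),
              ENNReal.div_mul_cancel hl0 htop, ← ENNReal.rpow_mul, mul_div_cancel₀ _ hp.ne']
          have e3 : y⁻¹ ^ ((p - q) / p) * y⁻¹ ^ (q / p) = y⁻¹ := by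
            rw [← ENNReal.rpow_add _ _ (by simpa using hyt) (by simpa using hy0), ← add_div,
              sub_add_cancel, div_self hp.ne', ENNReal.rpow_one]
          calc _ = y ^ q * y⁻¹ * distFn μ f y ^ (q / p) := by
                rw [ENNReal.rpow_sub _ _ hy0 hyt, ENNReal.rpow_one, div_eq_mul_inv]
            _ = (y ^ p / A.toFun y) ^ (q / p) * A.toFun y ^ (q / p) *
                  (y⁻¹ ^ ((p - q) / p) * y⁻¹ ^ (q / p)) * distFn μ f y ^ (q / p) := by rw [e2, e3]
            _ = _ := by
                rw [ENNReal.mul_rpow_of_nonneg _ _ (by positivity)]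
                simp only [mul_assoc, mul_comm, mul_left_comm]
    _ ≤ (∫⁻ l in Set.Ioi t, (X l ^ ((p - q) / p)) ^ (p / (p - q))) ^ (1 / (p / (p - q))) *
          (∫⁻ l in Set.Ioi t, (Y l ^ (q / p)) ^ (p / q)) ^ (1 / (p / q)) :=
        ENNReal.lintegral_mul_le_Lp_mul_Lq _ hconj (by fun_prop) (by fun_prop)
    _ = (∫⁻ l in Set.Ioi t, X l) ^ ((p - q) / p) * (∫⁻ l in Set.Ioi t, Y l) ^ (q / p) := by
        have e1 : (p - q) / p * (p / (p - q)) = 1 := by field_simp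
        have e2 : q / p * (p / q) = 1 := by field_simp
        simp only [← ENNReal.rpow_mul, e1, e2, ENNReal.rpow_one, one_div_div]
    _ ≤ (∫⁻ l in Set.Ioi t, X l) ^ ((p - q) / p) * 1 := by
        gcongr
        refine ENNReal.rpow_le_one ?_ (by positivity)
        exact ((lintegral_mono_set (Set.Ioi_subset_Ioi ht)).trans
          (lintegral_div_mul_distFn_le μ A hf)).trans hA1
    _ = _ := mul_one _

theorem setLIntegral_Ioi_zero_rpow_mul_distFn_le (μ : Measure R) [SFinite μ] (A : YoungFunction)
    {f : R → ℝ} (hf : Measurable f) (hA1 : ∫⁻ x, A.toFun (ENNReal.ofReal |f x|) ∂μ ≤ 1)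
    {p q : ℝ} (hq : 1 ≤ q) (hqp : q < p) {t : ℝ} (ht : 0 ≤ t)
    (hA0 : ∀ᵐ l ∂volume.restrict (Set.Ioi t), A.toFun (ENNReal.ofReal l) ≠ 0)
    {m : ℝ≥0∞} (hm : ∀ l, distFn μ f l ≤ m) :
    ∫⁻ l in Set.Ioi (0 : ℝ),
        ENNReal.ofReal l ^ (q - 1) * distFn μ f (ENNReal.ofReal l) ^ (q / p) ≤
      ENNReal.ofReal t ^ q * m ^ (q / p) +
      (∫⁻ l in Set.Ioi t, (ENNReal.ofReal l ^ p / A.toFun (ENNReal.ofReal l)) ^ (q / (p - q))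
        / ENNReal.ofReal l) ^ ((p - q) / p) := by
  have hq0 : 0 < q := by linarith
  have hp : 0 < p := by linarith
  rw [← Set.Ioc_union_Ioi_eq_Ioi ht]
  refine (lintegral_union_le _ _ _).trans
    (add_le_add ?_ (setLIntegral_rpow_mul_distFn_le μ A hf hA1 hq0 hqp ht hA0))
  calc _ ≤ ∫⁻ _ in Set.Ioc 0 t, ENNReal.ofReal t ^ (q - 1) * m ^ (q / p) := by
        refine setLIntegral_mono' measurableSet_Ioc fun l hl => ?_
        exact mul_le_mul' (ENNReal.rpow_le_rpow (ENNReal.ofReal_le_ofReal hl.2) (by linarith))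
          (ENNReal.rpow_le_rpow (hm _) (by positivity))
    _ = _ := by
        rw [setLIntegral_const, Real.volume_Ioc, sub_zero, mul_right_comm]
        congr 1
        nth_rewrite 2 [← ENNReal.rpow_one (ENNReal.ofReal t)]
        rw [← ENNReal.rpow_add_of_nonneg _ _ (by linarith) zero_le_one, sub_add_cancel]

theorem rearr_const_mul_le (μ : Measure R) (f : R → ℝ) {c : ℝ} (hc : 0 < c) (t : ℝ≥0∞) :
    rearr μ (fun x => c * f x) t ≤ ENNReal.ofReal c * rearr μ f t := by
  have hc0 : ENNReal.ofReal c ≠ 0 := by simpa using hc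
  rw [mul_comm, ← ENNReal.div_le_iff hc0 ENNReal.ofReal_ne_top]
  refine le_sInf fun l hl => ?_
  rw [ENNReal.div_le_iff hc0 ENNReal.ofReal_ne_top]
  refine sInf_le (show distFn μ _ _ ≤ t from le_trans (le_of_eq ?_) hl)
  simp only [distFn]
  congr 1
  ext x
  simp only [Set.mem_ofPred_eq]
  rw [abs_mul, abs_of_pos hc, ENNReal.ofReal_mul hc.le, mul_comm,
    ENNReal.mul_lt_mul_iff_right hc0 ENNReal.ofReal_ne_top]

theorem lorentzNorm_const_mul_le (μ : Measure R) (f : R → ℝ) {p q : ℝ} (hq : 0 < q) {c : ℝ}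
    (hc : 0 < c) :
    lorentzNorm μ (ENNReal.ofReal p) (ENNReal.ofReal q) (fun x => c * f x) ≤
      ENNReal.ofReal c * lorentzNorm μ (ENNReal.ofReal p) (ENNReal.ofReal q) f := by
  simp only [lorentzNorm, if_neg ENNReal.ofReal_ne_top, ENNReal.toReal_inv,
    ENNReal.toReal_ofReal hq.le]
  have hcq : ENNReal.ofReal c = (ENNReal.ofReal c ^ q) ^ q⁻¹ := by
    rw [← ENNReal.rpow_mul, mul_inv_cancel₀ hq.ne', ENNReal.rpow_one]
  rw [hcq, ← ENNReal.mul_rpow_of_nonneg _ _ (by positivity), ← lintegral_const_mul' _ _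
    (ENNReal.rpow_ne_top_of_nonneg hq.le ENNReal.ofReal_ne_top)]
  gcongr with t
  rw [← mul_div_assoc, ← ENNReal.mul_rpow_of_nonneg _ _ hq.le, mul_left_comm]
  gcongr
  exact rearr_const_mul_le μ f hc _

theorem lintegral_young_inv_mul_le_one {μ : Measure R} {A : YoungFunction} {f : R → ℝ} {c : ℝ}
    (hc : 0 < c) (h : luxNorm μ A f < ENNReal.ofReal c) :
    ∫⁻ x, A.toFun (ENNReal.ofReal |c⁻¹ * f x|) ∂μ ≤ 1 := by
  obtain ⟨l, ⟨-, hl⟩, hlc⟩ := sInf_lt_iff.1 h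
  refine (lintegral_mono fun x => A.mono ?_).trans hl
  rw [abs_mul, abs_of_pos (inv_pos.2 hc), ENNReal.ofReal_mul (inv_nonneg.2 hc.le),
    ENNReal.ofReal_inv_of_pos hc, mul_comm, ← div_eq_mul_inv]
  gcongr

theorem lorentzNorm_indicator_le (μ : Measure R) [SFinite μ] (A : YoungFunction) {f : R → ℝ}
    (hf : Measurable f) {c : ℝ} (hc : 0 < c) (hfc : luxNorm μ A f < ENNReal.ofReal c)
    {p q : ℝ} (hq : 1 ≤ q) (hqp : q < p) {t : ℝ} (ht : 0 ≤ t)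
    (hA0 : ∀ᵐ l ∂volume.restrict (Set.Ioi t), A.toFun (ENNReal.ofReal l) ≠ 0)
    {E : Set R} (hE : MeasurableSet E) :
    lorentzNorm μ (ENNReal.ofReal p) (ENNReal.ofReal q) (E.indicator f) ≤
      ENNReal.ofReal c * (ENNReal.ofReal p * (ENNReal.ofReal t ^ q * μ E ^ (q / p) +
      (∫⁻ l in Set.Ioi t, (ENNReal.ofReal l ^ p / A.toFun (ENNReal.ofReal l)) ^ (q / (p - q))
        / ENNReal.ofReal l) ^ ((p - q) / p))) ^ q⁻¹ := by
  have hq0 : 0 < q := by linarith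
  have hp : 0 < p := by linarith
  set g : R → ℝ := E.indicator fun x => c⁻¹ * f x
  have hg : Measurable g := (hf.const_mul _).indicator hE
  have hfg : E.indicator f = fun x => c * g x := by
    funext x
    by_cases hx : x ∈ E
    · simp [g, hx, hc.ne']
    · simp [g, hx]
  have hA1 : ∫⁻ x, A.toFun (ENNReal.ofReal |g x|) ∂μ ≤ 1 := by
    refine (lintegral_mono fun x => A.mono ?_).trans (lintegral_young_inv_mul_le_one hc hfc)
    refine ENNReal.ofReal_le_ofReal ?_
    by_cases hx : x ∈ E
    · simp [g, hx]
    · simp only [g, Set.indicator_of_notMem hx, abs_zero]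
      positivity
  have hm : ∀ l, distFn μ g l ≤ μ E := fun l => measure_mono fun x hx => by
    by_contra hxE
    simp [g, hxE] at hx
  rw [hfg]
  refine (lorentzNorm_const_mul_le μ g hq0 hc).trans ?_
  gcongr
  refine (lorentzNorm_ofReal_le μ g hp hq0).trans ?_
  gcongr
  exact setLIntegral_Ioi_zero_rpow_mul_distFn_le μ A hg hA1 hq hqp ht hA0 hm

theorem tendsto_setLIntegral_Ioi_atTop_zero {φ : ℝ → ℝ≥0∞} {c : ℝ}
    (h : ∫⁻ l in Set.Ioi c, φ l ≠ ⊤) :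
    Filter.Tendsto (fun t => ∫⁻ l in Set.Ioi t, φ l) Filter.atTop (nhds 0) := by
  have hν : ∀ t, volume.withDensity φ (Set.Ioi t) = ∫⁻ l in Set.Ioi t, φ l := fun t =>
    withDensity_apply _ measurableSet_Ioi
  have := tendsto_measure_iInter_atTop (μ := volume.withDensity φ) (s := fun t : ℝ => Set.Ioi t)
    (fun _ => measurableSet_Ioi.nullMeasurableSet) (fun _ _ hab => Set.Ioi_subset_Ioi hab)
    ⟨c, by rwa [hν]⟩
  have hempty : ⋂ t : ℝ, Set.Ioi t = ∅ := by
    ext x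
    simpa using ⟨x, le_rfl⟩
  rw [hempty, measure_empty] at this
  exact this.congr hν

theorem ae_young_ne_zero {A : YoungFunction} {p q c : ℝ} (hc : 0 < c) (hq : 0 < q) (hqp : q < p)
    (h : ∫⁻ t in Set.Ioi c, (ENNReal.ofReal t ^ p / A.toFun (ENNReal.ofReal t)) ^ (q / (p - q))
      / ENNReal.ofReal t ≠ ⊤) :
    ∀ᵐ l ∂volume.restrict (Set.Ioi c), A.toFun (ENNReal.ofReal l) ≠ 0 := by
  have hA : Measurable A.toFun := A.mono.measurable
  filter_upwards [ae_lt_top (by fun_prop) h, ae_restrict_mem measurableSet_Ioi] with l hl hcl h0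
  have hl0 : 0 < l := hc.trans hcl
  have hpow : ENNReal.ofReal l ^ p ≠ 0 :=
    (ENNReal.rpow_pos (by simpa using hl0) ENNReal.ofReal_ne_top).ne'
  rw [h0, ENNReal.div_zero hpow, ENNReal.top_rpow_of_pos (div_pos hq (sub_pos.2 hqp)),
    ENNReal.top_div_of_ne_top ENNReal.ofReal_ne_top] at hl
  exact lt_irrefl _ hl

/-- On any finite measure space, for a Young function `A`
and `1 ≤ q < p < ∞`, if `∫_c^∞ (t^p/A(t))^{q/(p-q)} dt/t < ∞` for some `c > 0`,
then the almost-compact embedding `L^A ↪* L^{p,q}` holds. -/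
theorem orlicz_lorentz_almost_compact_of_integral
    {R : Type*} [MeasurableSpace R] (μ : Measure R) (hfin : μ Set.univ < ⊤)
    (A : YoungFunction) (p q : ℝ) (hq : 1 ≤ q) (hqp : q < p)
    (h : ∃ c : ℝ, 0 < c ∧
      ∫⁻ t in Set.Ioi c,
        (ENNReal.ofReal t ^ p / A.toFun (ENNReal.ofReal t)) ^ (q / (p - q))
          / ENNReal.ofReal t < ⊤) :
    AlmostCompactEmbedding μ (luxNorm μ A)
      (lorentzNorm μ (ENNReal.ofReal p) (ENNReal.ofReal q)) := by
  obtain ⟨c, hc, h⟩ := h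
  have hq0 : 0 < q := by linarith
  have hp : 0 < p := by linarith
  have hpq : 0 < p - q := sub_pos.2 hqp
  have : IsFiniteMeasure μ := ⟨hfin⟩
  have hA0 := ae_young_ne_zero hc hq0 hqp h.ne
  constructor
  · intro f hf hfA
    obtain ⟨L, hL, hfL⟩ : ∃ L : ℝ, 0 < L ∧ luxNorm μ A f < ENNReal.ofReal L := by
      refine ⟨(luxNorm μ A f).toReal + 1, by positivity, ?_⟩
      rw [ENNReal.ofReal_add ENNReal.toReal_nonneg zero_le_one, ENNReal.ofReal_toReal hfA.ne,
        ENNReal.ofReal_one]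
      exact ENNReal.lt_add_right hfA.ne one_ne_zero
    have hle := lorentzNorm_indicator_le μ A hf hL hfL hq hqp hc.le hA0 MeasurableSet.univ
    rw [Set.indicator_univ] at hle
    refine hle.trans_lt (ENNReal.mul_lt_top ENNReal.ofReal_lt_top
      (ENNReal.rpow_lt_top_of_nonneg (by positivity) (ENNReal.mul_ne_top ENNReal.ofReal_ne_top
        (ENNReal.add_ne_top.2 ⟨ENNReal.mul_ne_top ?_ ?_, ?_⟩))))
    · exact ENNReal.rpow_ne_top_of_nonneg hq0.le ENNReal.ofReal_ne_top
    · exact ENNReal.rpow_ne_top_of_nonneg (by positivity) hfin.ne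
    · exact ENNReal.rpow_ne_top_of_nonneg (by positivity) h.ne
  · intro E hE hE0
    have hμE : Filter.Tendsto (fun n => μ (E n)) Filter.atTop (nhds 0) := by
      have := tendsto_measure_of_ae_tendsto_indicator_of_isFiniteMeasure (μ := μ) Filter.atTop
        MeasurableSet.empty hE ?_
      · simpa using this
      · filter_upwards [hE0] with x hx
        refine (tendsto_indicator_const_apply_iff_eventually (L := Filter.atTop) (A := ∅)
          (As := E) (1 : ℝ) x).1 ?_
        simpa using hx
    rw [ENNReal.tendsto_nhds_zero]
    intro ε hε
    have hbound : Filter.Tendsto (fun δ : ℝ≥0∞ =>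
        ENNReal.ofReal 2 * (ENNReal.ofReal p * (δ + δ)) ^ q⁻¹) (nhds 0) (nhds 0) := by
      have hcont : Continuous fun δ : ℝ≥0∞ =>
          ENNReal.ofReal 2 * (ENNReal.ofReal p * (δ + δ)) ^ q⁻¹ :=
        (ENNReal.continuous_const_mul ENNReal.ofReal_ne_top).comp
          (ENNReal.continuous_rpow_const.comp
            ((ENNReal.continuous_const_mul ENNReal.ofReal_ne_top).comp
              (continuous_id.add continuous_id)))
      have := hcont.tendsto 0
      simpa [hq0] using this
    obtain ⟨δ, hδε, hδ⟩ : ∃ δ : ℝ≥0∞,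
        ENNReal.ofReal 2 * (ENNReal.ofReal p * (δ + δ)) ^ q⁻¹ ≤ ε ∧ 0 < δ :=
      (((ENNReal.tendsto_nhds_zero.1 hbound ε hε).filter_mono nhdsWithin_le_nhds).and
        (self_mem_nhdsWithin (s := Set.Ioi (0 : ℝ≥0∞)))).exists
    have htail := ((ENNReal.continuous_rpow_const (y := (p - q) / p)).tendsto 0).comp
      (tendsto_setLIntegral_Ioi_atTop_zero h.ne)
    rw [ENNReal.zero_rpow_of_pos (by positivity), ENNReal.tendsto_nhds_zero] at htail
    obtain ⟨t, htδ, hct⟩ := ((htail δ hδ).and (Filter.eventually_ge_atTop c)).exists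
    have hhead : Filter.Tendsto (fun n => ENNReal.ofReal t ^ q * μ (E n) ^ (q / p))
        Filter.atTop (nhds 0) := by
      have := ENNReal.Tendsto.const_mul
        (((ENNReal.continuous_rpow_const (y := q / p)).tendsto 0).comp hμE)
        (Or.inr (ENNReal.rpow_ne_top_of_nonneg hq0.le (ENNReal.ofReal_ne_top (r := t))))
      rwa [ENNReal.zero_rpow_of_pos (by positivity), mul_zero] at this
    filter_upwards [ENNReal.tendsto_nhds_zero.1 hhead δ hδ] with n hn
    refine iSup_le fun f => ?_
    have hf2 : luxNorm μ A f.1 < ENNReal.ofReal 2 := f.2.2.trans_lt (by simp)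
    refine (lorentzNorm_indicator_le μ A f.2.1 two_pos hf2 hq hqp (hc.le.trans hct)
      (ae_restrict_of_ae_restrict_of_subset (Set.Ioi_subset_Ioi hct) hA0) (hE n)).trans
      (le_trans ?_ hδε)
    gcongr
    exact htδ
end
end

section
/- Let (R,μ) be a non-atomic measure space with 0 < μ(R) < ∞, let A be a Young function, and let 1 ≤ p ≤ q ≤ ∞. Then the following are equivalent: (a) the almost-compact embedding L^A ↪* L^p holds; (b) the almost-compact embedding L^A ↪* L^{p,q} holds; (c) p < ∞ and lim_{t→∞} A(t)/t^p = ∞. -/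
open MeasureTheory Filter Set ENNReal

noncomputable section

variable {R : Type*} [MeasurableSpace R]

open scoped Topology

/-! ### Layer cake comparison -/

lemma volume_restrict_Ioi_ofReal_lt (c : ℝ≥0∞) :
    (volume.restrict (Ioi (0 : ℝ))) {s | ENNReal.ofReal s < c} = c := by
  have hm : MeasurableSet {s : ℝ | ENNReal.ofReal s < c} :=
    measurableSet_lt ENNReal.measurable_ofReal measurable_const
  rw [Measure.restrict_apply hm]
  rcases eq_or_ne c ⊤ with rfl | hc
  · have : {s : ℝ | ENNReal.ofReal s < ⊤} ∩ Ioi 0 = Ioi 0 := by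
      ext s; simp
    rw [this, Real.volume_Ioi]
  · have : {s : ℝ | ENNReal.ofReal s < c} ∩ Ioi 0 = Ioo 0 c.toReal := by
      ext s
      simp only [mem_inter_iff, mem_ofPred_eq, mem_Ioi, mem_Ioo]
      constructor
      · rintro ⟨h1, h2⟩
        exact ⟨h2, (ENNReal.ofReal_lt_iff_lt_toReal h2.le hc).1 h1⟩
      · rintro ⟨h1, h2⟩
        exact ⟨(ENNReal.ofReal_lt_iff_lt_toReal h1.le hc).2 h2, h1⟩
    rw [this, Real.volume_Ioo, sub_zero, ENNReal.ofReal_toReal hc]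

lemma lintegral_eq_lintegral_measure_ofReal_lt {α : Type*} [MeasurableSpace α] (ν : Measure α)
    [SFinite ν] {k : α → ℝ≥0∞} (hk : Measurable k) :
    ∫⁻ x, k x ∂ν = ∫⁻ s in Ioi (0 : ℝ), ν {x | ENNReal.ofReal s < k x} := by
  have hS : MeasurableSet {z : α × ℝ | ENNReal.ofReal z.2 < k z.1} :=
    measurableSet_lt (ENNReal.measurable_ofReal.comp measurable_snd) (hk.comp measurable_fst)
  have h1 := Measure.prod_apply (μ := ν) (ν := volume.restrict (Ioi (0 : ℝ))) hS
  have h2 := Measure.prod_apply_symm (μ := ν) (ν := volume.restrict (Ioi (0 : ℝ))) hS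
  rw [h1] at h2
  simp only [preimage_ofPred_eq] at h2
  rw [← h2]
  exact lintegral_congr fun x => (volume_restrict_Ioi_ofReal_lt (k x)).symm

lemma lintegral_le_of_measure_lt_le {α β : Type*} [MeasurableSpace α] [MeasurableSpace β]
    {ν : Measure α} {μ : Measure β} [SFinite ν] [SFinite μ] {g : α → ℝ≥0∞} {h : β → ℝ≥0∞}
    (hg : Measurable g) (hh : Measurable h) (hgh : ∀ c, ν {x | c < g x} ≤ μ {x | c < h x}) :
    ∫⁻ x, g x ∂ν ≤ ∫⁻ x, h x ∂μ := by
  rw [lintegral_eq_lintegral_measure_ofReal_lt ν hg, lintegral_eq_lintegral_measure_ofReal_lt μ hh]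
  exact lintegral_mono fun s => hgh _

/-! ### Rearrangements and Lorentz functionals -/

section Lorentz

variable {μ : Measure R}

lemma rearr_antitone (f : R → ℝ) : Antitone (rearr μ f) := fun _ _ hst =>
  sInf_le_sInf fun _ hl => le_trans hl hst

lemma measurable_rearr_ofReal (f : R → ℝ) :
    Measurable fun t : ℝ => rearr μ f (ENNReal.ofReal t) :=
  (rearr_antitone f).measurable.comp ENNReal.measurable_ofReal

lemma lintegral_rearr_rpow_le [SFinite μ] {f : R → ℝ} (hf : Measurable f) {r : ℝ} (hr : 0 < r) :
    ∫⁻ t in Ioi (0 : ℝ), rearr μ f (ENNReal.ofReal t) ^ r ≤ ∫⁻ x, ENNReal.ofReal |f x| ^ r ∂μ := by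
  have hfm : Measurable fun x => ENNReal.ofReal |f x| :=
    ENNReal.measurable_ofReal.comp (continuous_abs.measurable.comp hf)
  refine lintegral_le_of_measure_lt_le ((measurable_rearr_ofReal f).pow_const r)
    (hfm.pow_const r) fun c => ?_
  have key : ∀ y : ℝ≥0∞, c < y ^ r ↔ c ^ r⁻¹ < y := fun y =>
    (ENNReal.rpow_inv_lt_iff hr).symm
  simp only [key]
  calc (volume.restrict (Ioi (0 : ℝ))) {t | c ^ r⁻¹ < rearr μ f (ENNReal.ofReal t)}
      ≤ (volume.restrict (Ioi (0 : ℝ))) {t | ENNReal.ofReal t < distFn μ f (c ^ r⁻¹)} := by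
        refine measure_mono fun t ht => ?_
        by_contra hcon
        have hdist : distFn μ f (c ^ r⁻¹) ≤ ENNReal.ofReal t := not_lt.1 hcon
        have hle : rearr μ f (ENNReal.ofReal t) ≤ c ^ r⁻¹ := sInf_le hdist
        exact not_lt_of_ge hle ht
    _ = μ {x | c ^ r⁻¹ < ENNReal.ofReal |f x|} := volume_restrict_Ioi_ofReal_lt _

lemma ofReal_rpow_mul_rpow_div {p : ℝ≥0∞} (hp : 1 ≤ p) (hpt : p ≠ ⊤) {t : ℝ} (ht : 0 < t)
    (y : ℝ≥0∞) :
    (ENNReal.ofReal t ^ (p⁻¹).toReal * y) ^ p.toReal / ENNReal.ofReal t = y ^ p.toReal := by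
  have hp0 : 0 < p.toReal := ENNReal.toReal_pos (by positivity) hpt
  have ht0 : ENNReal.ofReal t ≠ 0 := by simpa using ht
  rw [ENNReal.mul_rpow_of_nonneg _ _ hp0.le, ← ENNReal.rpow_mul, ENNReal.toReal_inv,
    inv_mul_cancel₀ hp0.ne', ENNReal.rpow_one, mul_comm,
    ENNReal.mul_div_cancel_right ht0 ENNReal.ofReal_ne_top]

lemma lorentzNorm_self {p : ℝ≥0∞} (hp : 1 ≤ p) (hpt : p ≠ ⊤) (f : R → ℝ) :
    lorentzNorm μ p p f =
      (∫⁻ t in Ioi (0 : ℝ), rearr μ f (ENNReal.ofReal t) ^ p.toReal) ^ (p⁻¹).toReal := by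
  rw [lorentzNorm, if_neg hpt]
  congr 1
  exact setLIntegral_congr_fun measurableSet_Ioi fun t ht => ofReal_rpow_mul_rpow_div hp hpt ht _

lemma ofReal_rpow_mul_rearr_le_lorentzNorm_self {p : ℝ≥0∞} (hp : 1 ≤ p) (hpt : p ≠ ⊤) (f : R → ℝ)
    (t : ℝ) :
    ENNReal.ofReal t ^ (p⁻¹).toReal * rearr μ f (ENNReal.ofReal t) ≤ lorentzNorm μ p p f := by
  have hp0 : 0 < p.toReal := ENNReal.toReal_pos (by positivity) hpt
  rw [lorentzNorm_self hp hpt]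
  have h1 : ENNReal.ofReal t * rearr μ f (ENNReal.ofReal t) ^ p.toReal ≤
      ∫⁻ t in Ioi (0 : ℝ), rearr μ f (ENNReal.ofReal t) ^ p.toReal := by
    calc ENNReal.ofReal t * rearr μ f (ENNReal.ofReal t) ^ p.toReal
        = ∫⁻ _ in Ioc (0 : ℝ) t, rearr μ f (ENNReal.ofReal t) ^ p.toReal := by
          rw [setLIntegral_const, Real.volume_Ioc, sub_zero, mul_comm]
      _ ≤ ∫⁻ s in Ioc (0 : ℝ) t, rearr μ f (ENNReal.ofReal s) ^ p.toReal :=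
          setLIntegral_mono' measurableSet_Ioc fun s hs =>
            ENNReal.rpow_le_rpow (rearr_antitone f (ENNReal.ofReal_le_ofReal hs.2)) hp0.le
      _ ≤ _ := lintegral_mono_set fun s hs => hs.1
  calc ENNReal.ofReal t ^ (p⁻¹).toReal * rearr μ f (ENNReal.ofReal t)
      = (ENNReal.ofReal t * rearr μ f (ENNReal.ofReal t) ^ p.toReal) ^ (p⁻¹).toReal := by
        rw [ENNReal.mul_rpow_of_nonneg _ _ ENNReal.toReal_nonneg, ← ENNReal.rpow_mul,
          ENNReal.toReal_inv, mul_inv_cancel₀ hp0.ne', ENNReal.rpow_one]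
    _ ≤ _ := ENNReal.rpow_le_rpow h1 ENNReal.toReal_nonneg

/-- Lorentz functionals decrease in the second exponent. -/
lemma lorentzNorm_le_lorentzNorm_self {p q : ℝ≥0∞} (hp : 1 ≤ p) (hpt : p ≠ ⊤) (hpq : p ≤ q)
    (f : R → ℝ) : lorentzNorm μ p q f ≤ lorentzNorm μ p p f := by
  have hp0 : 0 < p.toReal := ENNReal.toReal_pos (by positivity) hpt
  have hφ := ofReal_rpow_mul_rearr_le_lorentzNorm_self (μ := μ) hp hpt f
  rcases eq_or_ne q ⊤ with rfl | hqt
  · rw [lorentzNorm, if_pos rfl]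
    exact iSup_le fun t => hφ t.1
  have hpq' : p.toReal ≤ q.toReal := (ENNReal.toReal_le_toReal hpt hqt).2 hpq
  have hq0 : 0 < q.toReal := hp0.trans_le hpq'
  set N := lorentzNorm μ p p f with hN
  have hNp : ∫⁻ t in Ioi (0 : ℝ), rearr μ f (ENNReal.ofReal t) ^ p.toReal = N ^ p.toReal := by
    rw [hN, lorentzNorm_self hp hpt, ← ENNReal.rpow_mul, ENNReal.toReal_inv,
      inv_mul_cancel₀ hp0.ne', ENNReal.rpow_one]
  have hsplit : ∀ y : ℝ≥0∞, y ^ q.toReal = y ^ (q.toReal - p.toReal) * y ^ p.toReal := fun y => by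
    rw [← ENNReal.rpow_add_of_nonneg _ _ (sub_nonneg.2 hpq') hp0.le, sub_add_cancel]
  have hint : ∫⁻ t in Ioi (0 : ℝ),
      (ENNReal.ofReal t ^ (p⁻¹).toReal * rearr μ f (ENNReal.ofReal t)) ^ q.toReal
        / ENNReal.ofReal t ≤ N ^ q.toReal := by
    calc _ ≤ ∫⁻ t in Ioi (0 : ℝ), N ^ (q.toReal - p.toReal) *
          rearr μ f (ENNReal.ofReal t) ^ p.toReal := by
          refine setLIntegral_mono' measurableSet_Ioi fun t ht => ?_
          rw [hsplit, mul_div_assoc, ofReal_rpow_mul_rpow_div hp hpt ht]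
          gcongr
          exact hφ t
      _ = N ^ (q.toReal - p.toReal) * N ^ p.toReal := by
          rw [lintegral_const_mul _ ((measurable_rearr_ofReal f).pow_const _), hNp]
      _ = N ^ q.toReal := (hsplit N).symm
  rw [lorentzNorm, if_neg hqt]
  calc _ ≤ (N ^ q.toReal) ^ (q⁻¹).toReal := ENNReal.rpow_le_rpow hint ENNReal.toReal_nonneg
    _ = N := by
      rw [← ENNReal.rpow_mul, ENNReal.toReal_inv, mul_inv_cancel₀ hq0.ne', ENNReal.rpow_one]

lemma le_rearr_indicator_const {E : Set R} {c : ℝ} {t : ℝ≥0∞} (ht : t < μ E) :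
    ENNReal.ofReal |c| ≤ rearr μ (E.indicator fun _ => c) t := by
  refine le_sInf fun l hl => ?_
  by_contra hcon
  have hsub : E ⊆ {x | l < ENNReal.ofReal |E.indicator (fun _ => c) x|} := fun x hx => by
    simpa [hx] using hcon
  exact absurd ((measure_mono hsub).trans hl) (not_le.2 ht)

lemma le_lorentzNorm_indicator_const {p q : ℝ≥0∞} (hq : 1 ≤ q) {E : Set R} (hE0 : μ E ≠ 0)
    (hE : μ E ≠ ⊤) (c : ℝ) :
    2⁻¹ * ((μ E / 2) ^ (p⁻¹).toReal * ENNReal.ofReal |c|) ≤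
      lorentzNorm μ p q (E.indicator fun _ => c) := by
  set m : ℝ := (μ E).toReal with hm
  have hm0 : 0 < m := ENNReal.toReal_pos hE0 hE
  have hmE : μ E = ENNReal.ofReal m := (ENNReal.ofReal_toReal hE).symm
  have hm2 : μ E / 2 = ENNReal.ofReal (m / 2) := by
    rw [hmE, ENNReal.ofReal_div_of_pos two_pos, ENNReal.ofReal_ofNat]
  set B := (μ E / 2) ^ (p⁻¹).toReal * ENNReal.ofReal |c| with hB
  have hle : ∀ t ∈ Ico (m / 2) m, B ≤ ENNReal.ofReal t ^ (p⁻¹).toReal *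
      rearr μ (E.indicator fun _ => c) (ENNReal.ofReal t) := fun t ht => by
    rw [hB, hm2]
    gcongr
    · exact ht.1
    · refine le_rearr_indicator_const ?_
      rw [hmE]
      exact (ENNReal.ofReal_lt_ofReal_iff hm0).2 ht.2
  have hhalf : (2⁻¹ : ℝ≥0∞) ≤ 1 := by simp
  rcases eq_or_ne q ⊤ with rfl | hqt
  · rw [lorentzNorm, if_pos rfl]
    calc 2⁻¹ * B ≤ 1 * B := by gcongr
      _ = B := one_mul B
      _ ≤ _ := hle (m / 2) ⟨le_rfl, by linarith⟩
      _ ≤ _ := le_iSup (fun t : Ioi (0 : ℝ) => ENNReal.ofReal t.1 ^ (p⁻¹).toReal *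
          rearr μ (E.indicator fun _ => c) (ENNReal.ofReal t.1)) ⟨m / 2, half_pos hm0⟩
  have hq0 : 0 < q.toReal := ENNReal.toReal_pos (by positivity) hqt
  have hq1 : (q⁻¹).toReal ≤ 1 := by
    have : q⁻¹ ≤ 1 := ENNReal.inv_le_one.2 hq
    simpa using ENNReal.toReal_mono ENNReal.one_ne_top this
  rw [lorentzNorm, if_neg hqt]
  have hint : 2⁻¹ * B ^ q.toReal ≤ ∫⁻ t in Ioi (0 : ℝ),
      (ENNReal.ofReal t ^ (p⁻¹).toReal * rearr μ (E.indicator fun _ => c) (ENNReal.ofReal t))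
        ^ q.toReal / ENNReal.ofReal t := by
    calc 2⁻¹ * B ^ q.toReal
        = ∫⁻ _ in Ico (m / 2) m, B ^ q.toReal / ENNReal.ofReal m := by
          rw [setLIntegral_const, Real.volume_Ico, show m - m / 2 = m / 2 by ring, mul_comm,
            div_eq_mul_inv, mul_assoc,
            ENNReal.ofReal_div_of_pos two_pos, ENNReal.ofReal_ofNat, div_eq_mul_inv,
            ← mul_assoc (ENNReal.ofReal m)⁻¹, ENNReal.inv_mul_cancel (by simpa using hm0)
            ENNReal.ofReal_ne_top, one_mul]
      _ ≤ ∫⁻ t in Ico (m / 2) m, (ENNReal.ofReal t ^ (p⁻¹).toReal *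
            rearr μ (E.indicator fun _ => c) (ENNReal.ofReal t)) ^ q.toReal
              / ENNReal.ofReal t := by
          refine setLIntegral_mono' measurableSet_Ico fun t ht => ?_
          gcongr
          · exact hle t ht
          · exact ht.2.le
      _ ≤ _ := lintegral_mono_set fun t ht => (half_pos hm0).trans_le ht.1
  calc 2⁻¹ * B ≤ (2⁻¹ : ℝ≥0∞) ^ (q⁻¹).toReal * B := by
        gcongr
        simpa using ENNReal.rpow_le_rpow_of_exponent_ge hhalf hq1
    _ = (2⁻¹ * B ^ q.toReal) ^ (q⁻¹).toReal := by
        rw [ENNReal.mul_rpow_of_nonneg _ _ ENNReal.toReal_nonneg, ← ENNReal.rpow_mul,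
          ENNReal.toReal_inv, mul_inv_cancel₀ hq0.ne', ENNReal.rpow_one]
    _ ≤ _ := ENNReal.rpow_le_rpow hint ENNReal.toReal_nonneg

/-! ### Sets of prescribed size in non-atomic spaces -/

lemma NonAtomic.exists_subset_measure_le (hna : NonAtomic μ) {s : Set R} (hs : MeasurableSet s)
    (hs0 : 0 < μ s) (hst : μ s ≠ ⊤) {δ : ℝ≥0∞} (hδ : 0 < δ) :
    ∃ t ⊆ s, MeasurableSet t ∧ 0 < μ t ∧ μ t ≤ δ := by
  have halve : ∀ n : ℕ, ∃ t ⊆ s, MeasurableSet t ∧ 0 < μ t ∧ μ t ≤ μ s * 2⁻¹ ^ n := by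
    intro n
    induction n with
    | zero => exact ⟨s, subset_rfl, hs, hs0, by simp⟩
    | succ n ih =>
      obtain ⟨t, hts, htm, ht0, htle⟩ := ih
      obtain ⟨u, hut, hum, hu0, hult⟩ := hna t htm ht0
      have hadd : μ u + μ (t \ u) = μ t := by
        rw [← measure_inter_add_sdiff t hum, inter_eq_self_of_subset_right hut]
      have hbound : μ t * 2⁻¹ ≤ μ s * 2⁻¹ ^ (n + 1) := by
        rw [pow_succ, ← mul_assoc]; gcongr
      rcases le_total (μ u) (μ t * 2⁻¹) with h | h
      · exact ⟨u, hut.trans hts, hum, hu0, h.trans hbound⟩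
      · refine ⟨t \ u, sdiff_subset.trans hts, htm.diff hum, ?_, le_trans ?_ hbound⟩
        · rw [pos_iff_ne_zero]
          intro h0
          rw [h0, add_zero] at hadd
          exact hult.ne hadd
        · by_contra hcon
          have hut' : μ u ≠ ⊤ := ((measure_mono (hut.trans hts)).trans_lt hst.lt_top).ne
          have hlt := ENNReal.add_lt_add_of_le_of_lt (ne_top_of_le_ne_top hut' h) h
            (not_le.1 hcon)
          rw [hadd, ← mul_add, ENNReal.inv_two_add_inv_two, mul_one] at hlt
          exact lt_irrefl _ hlt
  have hlim : Tendsto (fun n : ℕ => μ s * 2⁻¹ ^ n) atTop (𝓝 0) := by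
    have := ENNReal.Tendsto.const_mul (a := μ s)
      (ENNReal.tendsto_pow_atTop_nhds_zero_of_lt_one (r := 2⁻¹) (by simp)) (Or.inr hst)
    simpa using this
  obtain ⟨n, hn⟩ := (hlim.eventually (gt_mem_nhds hδ)).exists
  obtain ⟨t, hts, htm, ht0, htle⟩ := halve n
  exact ⟨t, hts, htm, ht0, htle.trans hn.le⟩

lemma NonAtomic.exists_measure_mem_Ioc (hna : NonAtomic μ) (hfin : μ univ < ⊤) {ε : ℝ≥0∞}
    (hε : 0 < ε) (hεμ : ε ≤ μ univ) : ∃ E, MeasurableSet E ∧ ε / 2 < μ E ∧ μ E ≤ ε := by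
  by_contra! hcon
  have hεt : ε ≠ ⊤ := (hεμ.trans_lt hfin).ne
  have hsmall : ∀ E, MeasurableSet E → μ E ≤ ε → μ E ≤ ε / 2 := fun E hE h => by
    by_contra h'
    exact absurd h (not_le.2 (hcon E hE (not_le.1 h')))
  have hunion : ∀ E F, MeasurableSet E → MeasurableSet F → μ E ≤ ε / 2 → μ F ≤ ε / 2 →
      μ (E ∪ F) ≤ ε / 2 := fun E F hE hF h1 h2 =>
    hsmall _ (hE.union hF) <| (measure_union_le E F).trans <|
      (add_le_add h1 h2).trans (ENNReal.add_halves ε).le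
  let S : Set ℝ≥0∞ := {r | ∃ E, MeasurableSet E ∧ μ E ≤ ε / 2 ∧ μ E = r}
  have hS : S.Nonempty := ⟨0, ∅, MeasurableSet.empty, by simp, by simp⟩
  obtain ⟨u, -, hu, huS⟩ := exists_seq_tendsto_sSup hS (OrderTop.bddAbove S)
  choose E hEm hEle hEu using huS
  have hacc : ∀ n, MeasurableSet (accumulate E n) ∧ μ (accumulate E n) ≤ ε / 2 := fun n => by
    induction n with
    | zero => simpa using ⟨hEm 0, hEle 0⟩
    | succ n ih =>
      rw [accumulate_succ]
      exact ⟨ih.1.union (hEm _), hunion _ _ ih.1 (hEm _) ih.2 (hEle _)⟩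
  have hFm : MeasurableSet (⋃ n, E n) := MeasurableSet.iUnion hEm
  have hF : μ (⋃ n, E n) ≤ ε / 2 :=
    le_of_tendsto' tendsto_measure_iUnion_accumulate fun n => (hacc n).2
  have hsup : sSup S ≤ μ (⋃ n, E n) :=
    le_of_tendsto' hu fun n => (hEu n) ▸ measure_mono (subset_iUnion E n)
  have hε2 : ε / 2 < ε := ENNReal.half_lt_self hε.ne' hεt
  have hcompl : 0 < μ (⋃ n, E n)ᶜ := by
    rw [pos_iff_ne_zero]
    intro h0
    have := measure_add_measure_compl (μ := μ) hFm
    rw [h0, add_zero] at this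
    exact absurd (hεμ.trans (this ▸ hF)) (not_le.2 hε2)
  obtain ⟨G, hGsub, hGm, hG0, hGle⟩ := hna.exists_subset_measure_le hFm.compl hcompl
    ((measure_mono (subset_univ _)).trans_lt hfin).ne (ENNReal.half_pos hε.ne')
  have hdisj : Disjoint (⋃ n, E n) G := (disjoint_compl_right).mono_right hGsub
  have hmem : μ ((⋃ n, E n) ∪ G) ≤ sSup S :=
    le_sSup ⟨_, hFm.union hGm, hunion _ _ hFm hGm hF hGle, rfl⟩
  rw [measure_union hdisj hGm] at hmem
  have hFt : μ (⋃ n, E n) ≠ ⊤ := ((measure_mono (subset_univ _)).trans_lt hfin).ne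
  exact absurd (hmem.trans hsup) (not_le.2 (ENNReal.lt_add_right hFt hG0.ne'))

/-! ### Almost-compact embeddings -/

lemma AlmostCompactEmbedding.mono_right {NX NY NZ : (R → ℝ) → ℝ≥0∞}
    (h : AlmostCompactEmbedding μ NX NY) (hle : ∀ f, NZ f ≤ NY f) :
    AlmostCompactEmbedding μ NX NZ :=
  ⟨fun f hf hX => (hle f).trans_lt (h.1 f hf hX), fun E hE hlim =>
    tendsto_of_tendsto_of_tendsto_of_le_of_le tendsto_const_nhds (h.2 E hE hlim)
      (fun _ => bot_le) fun _ => iSup_mono fun _ => hle _⟩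

lemma luxNorm_indicator_const_le_one (A : YoungFunction) {E : Set R} (hE : MeasurableSet E)
    {c : ℝ} (hc : 0 ≤ c) (h : A.toFun (ENNReal.ofReal c) * μ E ≤ 1) :
    luxNorm μ A (E.indicator fun _ => c) ≤ 1 := by
  refine sInf_le ⟨one_pos, ?_⟩
  have heq : ∀ x, A.toFun (ENNReal.ofReal |E.indicator (fun _ => c) x| / 1) =
      E.indicator (fun _ => A.toFun (ENNReal.ofReal c)) x := fun x => by
    by_cases hx : x ∈ E <;> simp [hx, abs_of_nonneg hc, A.map_zero]
  simp_rw [heq]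
  rwa [lintegral_indicator_const hE]

/-- Normalized multiples of characteristic functions obstruct almost-compactness. -/
lemma not_almostCompactEmbedding_of_indicators {A : YoungFunction} {p q : ℝ≥0∞} (hq : 1 ≤ q)
    {E : ℕ → Set R} {c : ℕ → ℝ} {δ : ℝ≥0∞} (hδ : 0 < δ) (hE : ∀ n, MeasurableSet (E n))
    (hE0 : ∀ n, μ (E n) ≠ 0) (hEle : ∀ n, μ (E n) ≤ 2⁻¹ ^ n) (hc : ∀ n, 0 ≤ c n)
    (hA : ∀ n, A.toFun (ENNReal.ofReal (c n)) * μ (E n) ≤ 1)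
    (hlow : ∀ n, δ ≤ (μ (E n) / 2) ^ (p⁻¹).toReal * ENNReal.ofReal (c n)) :
    ¬ AlmostCompactEmbedding μ (luxNorm μ A) (lorentzNorm μ p q) := by
  intro h
  have hsum : ∑' n, μ (E n) ≠ ⊤ := by
    refine ne_top_of_le_ne_top ?_ (ENNReal.tsum_le_tsum hEle)
    rw [ENNReal.tsum_geometric]
    simp
  have hlim := h.2 E hE <| by
    filter_upwards [ae_eventually_notMem hsum] with x hx
    refine tendsto_const_nhds.congr' ?_
    filter_upwards [hx] with n hn
    simp [hn]
  have hge : ∀ n, 2⁻¹ * δ ≤ ⨆ f : {f : R → ℝ // Measurable f ∧ luxNorm μ A f ≤ 1},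
      lorentzNorm μ p q ((E n).indicator f.1) := fun n => by
    have hEt : μ (E n) ≠ ⊤ := ne_top_of_le_ne_top (by finiteness) (hEle n)
    refine le_trans ?_ (le_iSup _ ⟨(E n).indicator fun _ => c n,
      measurable_const.indicator (hE n), luxNorm_indicator_const_le_one A (hE n) (hc n) (hA n)⟩)
    simp only [indicator_indicator, inter_self]
    refine le_trans ?_ (le_lorentzNorm_indicator_const hq (hE0 n) hEt (c n))
    rw [abs_of_nonneg (hc n)]
    gcongr
    exact hlow n
  have hle := ge_of_tendsto' hlim hge
  have : 0 < 2⁻¹ * δ := ENNReal.mul_pos (by simp) hδ.ne'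
  exact absurd hle (not_le.2 this)

lemma YoungFunction.exists_pos_mul_le_one (A : YoungFunction) {M : ℝ≥0∞} (hM : M ≠ ⊤) :
    ∃ c : ℝ, 0 < c ∧ A.toFun (ENNReal.ofReal c) * M ≤ 1 := by
  have hlim : Tendsto (fun t => A.toFun t * M) (𝓝[>] 0) (𝓝 0) := by
    simpa using ENNReal.Tendsto.mul_const A.tendsto_zero (Or.inr hM)
  have hlt : Iio (⊤ : ℝ≥0∞) ∈ 𝓝[>] (0 : ℝ≥0∞) :=
    mem_nhdsWithin_of_mem_nhds (Iio_mem_nhds ENNReal.zero_lt_top)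
  have : (𝓝[>] (0 : ℝ≥0∞)).NeBot := nhdsGT_neBot_of_exists_gt ⟨1, one_pos⟩
  obtain ⟨t, ⟨ht1, ht2⟩, ht0⟩ := (((hlim.eventually (gt_mem_nhds one_pos)).and hlt).and
    self_mem_nhdsWithin).exists
  refine ⟨t.toReal, ENNReal.toReal_pos (ne_of_gt ht0) (ne_of_lt ht2), ?_⟩
  rw [ENNReal.ofReal_toReal (ne_of_lt ht2)]
  exact ht1.le

lemma not_almostCompactEmbedding_top (hna : NonAtomic μ) (hpos : 0 < μ univ) (hfin : μ univ < ⊤)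
    (A : YoungFunction) {q : ℝ≥0∞} (hq : 1 ≤ q) :
    ¬ AlmostCompactEmbedding μ (luxNorm μ A) (lorentzNorm μ ⊤ q) := by
  obtain ⟨c, hc, hcA⟩ := A.exists_pos_mul_le_one hfin.ne
  choose E _ hEm hE0 hEle using fun n : ℕ =>
    hna.exists_subset_measure_le MeasurableSet.univ hpos hfin.ne (δ := 2⁻¹ ^ n)
      (ENNReal.pow_pos (by simp) n)
  refine not_almostCompactEmbedding_of_indicators hq (δ := ENNReal.ofReal c) (c := fun _ => c)
    (by simpa using hc) hEm (fun n => (hE0 n).ne') hEle (fun _ => hc.le) (fun n => ?_)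
    fun n => by simp
  exact le_trans (by gcongr; exact subset_univ _) hcA

lemma AlmostCompactEmbedding.tendsto_young_div_rpow (hna : NonAtomic μ) (hpos : 0 < μ univ)
    (hfin : μ univ < ⊤) {A : YoungFunction} {p q : ℝ≥0∞} (hp : 1 ≤ p) (hpt : p ≠ ⊤) (hq : 1 ≤ q)
    (h : AlmostCompactEmbedding μ (luxNorm μ A) (lorentzNorm μ p q)) :
    Tendsto (fun t : ℝ => A.toFun (ENNReal.ofReal t) / ENNReal.ofReal t ^ p.toReal)
      atTop (𝓝 ⊤) := by
  have hp0 : 0 < p.toReal := ENNReal.toReal_pos (by positivity) hpt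
  by_contra hcon
  rw [ENNReal.tendsto_nhds_top_iff_nnreal] at hcon
  push Not at hcon
  obtain ⟨K₀, hK₀⟩ := hcon
  set K : ℝ≥0∞ := K₀ + 1 with hK
  have hKt : K ≠ ⊤ := by finiteness
  have hK0 : K ≠ 0 := by simp [hK]
  have hinv : Tendsto (fun t : ℝ => (K * ENNReal.ofReal t ^ p.toReal)⁻¹) atTop (𝓝 0) := by
    have h1 : Tendsto (fun t : ℝ => ENNReal.ofReal t ^ p.toReal) atTop (𝓝 ⊤) := by
      have := (ENNReal.continuous_rpow_const (y := p.toReal)).tendsto ⊤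
      rw [ENNReal.top_rpow_of_pos hp0] at this
      exact this.comp ENNReal.tendsto_ofReal_atTop
    have h2 := ENNReal.Tendsto.const_mul (a := K) h1 (Or.inl ENNReal.top_ne_zero)
    rw [ENNReal.mul_top hK0] at h2
    simpa using tendsto_inv_iff.2 h2
  have hex : ∀ n : ℕ, ∃ t : ℝ, 0 < t ∧
      A.toFun (ENNReal.ofReal t) ≤ K * ENNReal.ofReal t ^ p.toReal ∧
      (K * ENNReal.ofReal t ^ p.toReal)⁻¹ ≤ 2⁻¹ ^ n ∧
      (K * ENNReal.ofReal t ^ p.toReal)⁻¹ ≤ μ univ := fun n => by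
    obtain ⟨t, ht, ⟨h1, h2⟩, h3⟩ := (hK₀.and_eventually
      (((hinv.eventually (gt_mem_nhds (ENNReal.pow_pos (a := 2⁻¹) (by simp) n))).and
        (hinv.eventually (gt_mem_nhds hpos))).and (eventually_gt_atTop 0))).exists
    refine ⟨t, h3, ?_, h1.le, h2.le⟩
    have ht0 : ENNReal.ofReal t ^ p.toReal ≠ 0 := by
      simp [ENNReal.rpow_eq_zero_iff, h3, hp0]
    have htt : ENNReal.ofReal t ^ p.toReal ≠ ⊤ := by finiteness
    have := (ENNReal.div_le_iff ht0 htt).1 (le_trans ht (le_self_add (b := (1 : ℝ≥0∞))))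
    exact this
  choose c hc0 hcA hc2 hcμ using hex
  have hX0 : ∀ n, K * ENNReal.ofReal (c n) ^ p.toReal ≠ 0 := fun n =>
    mul_ne_zero hK0 (by simp [ENNReal.rpow_eq_zero_iff, hc0 n, hp0])
  have hXt : ∀ n, K * ENNReal.ofReal (c n) ^ p.toReal ≠ ⊤ := fun n =>
    ENNReal.mul_ne_top hKt (by finiteness)
  choose E hEm hElt hEle using fun n => hna.exists_measure_mem_Ioc hfin
    (ENNReal.inv_pos.2 (hXt n)) (hcμ n)
  refine not_almostCompactEmbedding_of_indicators hq
    (δ := (K⁻¹ / 2 / 2) ^ (p⁻¹).toReal) (c := c) ?_ hEm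
    (fun n => (bot_le.trans_lt (hElt n)).ne') (fun n => (hEle n).trans (hc2 n))
    (fun n => (hc0 n).le) (fun n => ?_) (fun n => ?_) h
  · exact ENNReal.rpow_pos (by simp [ENNReal.div_pos_iff, hKt]) (by finiteness)
  · calc A.toFun (ENNReal.ofReal (c n)) * μ (E n)
        ≤ (K * ENNReal.ofReal (c n) ^ p.toReal) * (K * ENNReal.ofReal (c n) ^ p.toReal)⁻¹ := by
          gcongr
          · exact hcA n
          · exact hEle n
      _ = 1 := ENNReal.mul_inv_cancel (hX0 n) (hXt n)
  · have hroot : ENNReal.ofReal (c n) =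
        (ENNReal.ofReal (c n) ^ p.toReal) ^ (p⁻¹).toReal := by
      rw [← ENNReal.rpow_mul, ENNReal.toReal_inv, mul_inv_cancel₀ hp0.ne', ENNReal.rpow_one]
    rw [hroot, ← ENNReal.mul_rpow_of_nonneg _ _ ENNReal.toReal_nonneg]
    refine ENNReal.rpow_le_rpow ?_ ENNReal.toReal_nonneg
    have hc' : ENNReal.ofReal (c n) ^ p.toReal ≠ 0 := right_ne_zero_of_mul (hX0 n)
    have hc'' : ENNReal.ofReal (c n) ^ p.toReal ≠ ⊤ := by finiteness
    calc K⁻¹ / 2 / 2 = (K * ENNReal.ofReal (c n) ^ p.toReal)⁻¹ / 2 / 2 *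
          ENNReal.ofReal (c n) ^ p.toReal := by
          rw [ENNReal.mul_inv (Or.inl hK0) (Or.inl hKt)]
          simp only [div_eq_mul_inv]
          calc K⁻¹ * 2⁻¹ * 2⁻¹ = K⁻¹ * 2⁻¹ * 2⁻¹ *
                ((ENNReal.ofReal (c n) ^ p.toReal)⁻¹ * ENNReal.ofReal (c n) ^ p.toReal) := by
                rw [ENNReal.inv_mul_cancel hc' hc'', mul_one]
            _ = _ := by ring
      _ ≤ _ := by
          gcongr
          exact (hElt n).le

lemma YoungFunction.exists_mul_rpow_le {A : YoungFunction} {p : ℝ≥0∞}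
    (hA : Tendsto (fun t : ℝ => A.toFun (ENNReal.ofReal t) / ENNReal.ofReal t ^ p.toReal)
      atTop (𝓝 ⊤)) (K : NNReal) :
    ∃ T : ℝ, ∀ s, ENNReal.ofReal T ≤ s → K * s ^ p.toReal ≤ A.toFun s := by
  obtain ⟨T, hT⟩ := eventually_atTop.1 (ENNReal.tendsto_nhds_top_iff_nnreal.1 hA K)
  refine ⟨max T 1, fun s hs => ?_⟩
  rcases eq_or_ne s ⊤ with rfl | hst
  · simp [A.map_top]
  have hs' : max T 1 ≤ s.toReal := (ENNReal.ofReal_le_iff_le_toReal hst).1 hs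
  have := hT s.toReal ((le_max_left _ _).trans hs')
  rw [ENNReal.ofReal_toReal hst] at this
  have hs0 : 0 < s.toReal := lt_of_lt_of_le one_pos ((le_max_right _ _).trans hs')
  have hsp : s ≠ 0 := (ENNReal.toReal_pos_iff.1 hs0).1.ne'
  exact (ENNReal.le_div_iff_mul_le
    (Or.inl (ENNReal.rpow_pos (pos_iff_ne_zero.2 hsp) hst).ne')
    (Or.inl (by finiteness))).1 this.le

/-- The `p`-th power mass of `f` on `E` is controlled by the modular of `f / lam`. -/
lemma lorentzNorm_indicator_le_s5 {A : YoungFunction} {p : ℝ≥0∞} (hp : 1 ≤ p) (hpt : p ≠ ⊤)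
    (hfin : μ univ < ⊤) {K : NNReal} (hK : K ≠ 0) {T : ℝ}
    (hT : ∀ s, ENNReal.ofReal T ≤ s → K * s ^ p.toReal ≤ A.toFun s)
    {f : R → ℝ} (hf : Measurable f) {lam : ℝ≥0∞} (hlam0 : lam ≠ 0) (hlam : lam ≠ ⊤)
    (hfA : ∫⁻ x, A.toFun (ENNReal.ofReal |f x| / lam) ∂μ ≤ 1)
    {E : Set R} (hE : MeasurableSet E) :
    lorentzNorm μ p p (E.indicator f) ≤
      lam * (ENNReal.ofReal T ^ p.toReal * μ E + (K : ℝ≥0∞)⁻¹) ^ (p⁻¹).toReal := by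
  have : IsFiniteMeasure μ := ⟨hfin⟩
  have hp0 : 0 < p.toReal := ENNReal.toReal_pos (by positivity) hpt
  have hK0 : (K : ℝ≥0∞) ≠ 0 := by simpa using hK
  have hpt' : ∀ s : ℝ≥0∞, s ^ p.toReal ≤
      ENNReal.ofReal T ^ p.toReal + (K : ℝ≥0∞)⁻¹ * A.toFun s := fun s => by
    rcases le_total s (ENNReal.ofReal T) with h | h
    · exact le_add_right (ENNReal.rpow_le_rpow h hp0.le)
    · refine le_add_left ?_
      calc s ^ p.toReal = (K : ℝ≥0∞)⁻¹ * (K * s ^ p.toReal) := by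
            rw [← mul_assoc, ENNReal.inv_mul_cancel hK0 ENNReal.coe_ne_top, one_mul]
        _ ≤ _ := by gcongr; exact hT s h
  have hint : ∫⁻ x, ENNReal.ofReal |E.indicator f x| ^ p.toReal ∂μ ≤
      lam ^ p.toReal * (ENNReal.ofReal T ^ p.toReal * μ E + (K : ℝ≥0∞)⁻¹) := by
    calc ∫⁻ x, ENNReal.ofReal |E.indicator f x| ^ p.toReal ∂μ
        = ∫⁻ x in E, ENNReal.ofReal |f x| ^ p.toReal ∂μ := by
          rw [← lintegral_indicator hE]
          refine lintegral_congr fun x => ?_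
          by_cases hx : x ∈ E <;> simp [hx, hp0]
      _ ≤ ∫⁻ x in E, lam ^ p.toReal * (ENNReal.ofReal T ^ p.toReal +
            (K : ℝ≥0∞)⁻¹ * A.toFun (ENNReal.ofReal |f x| / lam)) ∂μ := by
          refine lintegral_mono fun x => ?_
          calc ENNReal.ofReal |f x| ^ p.toReal
              = lam ^ p.toReal * (ENNReal.ofReal |f x| / lam) ^ p.toReal := by
                rw [← ENNReal.mul_rpow_of_nonneg _ _ hp0.le, ENNReal.mul_div_cancel hlam0 hlam]
            _ ≤ _ := by gcongr; exact hpt' _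
      _ = lam ^ p.toReal * (ENNReal.ofReal T ^ p.toReal * μ E +
            (K : ℝ≥0∞)⁻¹ * ∫⁻ x in E, A.toFun (ENNReal.ofReal |f x| / lam) ∂μ) := by
          rw [lintegral_const_mul' _ _ (by finiteness), lintegral_add_left measurable_const,
            setLIntegral_const, lintegral_const_mul' _ _ (ENNReal.inv_ne_top.2 hK0)]
      _ ≤ lam ^ p.toReal * (ENNReal.ofReal T ^ p.toReal * μ E + (K : ℝ≥0∞)⁻¹ * 1) := by
          gcongr
          exact (setLIntegral_le_lintegral _ _).trans hfA
      _ = _ := by rw [mul_one]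
  rw [lorentzNorm_self hp hpt]
  calc _ ≤ (lam ^ p.toReal * (ENNReal.ofReal T ^ p.toReal * μ E + (K : ℝ≥0∞)⁻¹)) ^
        (p⁻¹).toReal :=
        ENNReal.rpow_le_rpow ((lintegral_rearr_rpow_le (hf.indicator hE) hp0).trans hint)
          ENNReal.toReal_nonneg
    _ = _ := by
        rw [ENNReal.mul_rpow_of_nonneg _ _ ENNReal.toReal_nonneg, ← ENNReal.rpow_mul,
          ENNReal.toReal_inv, mul_inv_cancel₀ hp0.ne', ENNReal.rpow_one]

lemma exists_modular_le_one_of_luxNorm_lt {A : YoungFunction} {f : R → ℝ} {c : ℝ≥0∞}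
    (h : luxNorm μ A f < c) :
    ∃ lam, lam ≠ 0 ∧ lam < c ∧ ∫⁻ x, A.toFun (ENNReal.ofReal |f x| / lam) ∂μ ≤ 1 := by
  obtain ⟨lam, ⟨h0, h1⟩, hlt⟩ := sInf_lt_iff.1 h
  exact ⟨lam, h0.ne', hlt, h1⟩

lemma almostCompactEmbedding_of_tendsto (hfin : μ univ < ⊤) {A : YoungFunction} {p : ℝ≥0∞}
    (hp : 1 ≤ p) (hpt : p ≠ ⊤)
    (hA : Tendsto (fun t : ℝ => A.toFun (ENNReal.ofReal t) / ENNReal.ofReal t ^ p.toReal)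
      atTop (𝓝 ⊤)) :
    AlmostCompactEmbedding μ (luxNorm μ A) (lorentzNorm μ p p) := by
  have : IsFiniteMeasure μ := ⟨hfin⟩
  have hp0 : 0 < p.toReal := ENNReal.toReal_pos (by positivity) hpt
  have hpi : 0 < (p⁻¹).toReal := by rw [ENNReal.toReal_inv]; positivity
  constructor
  · intro f hf hX
    obtain ⟨T, hT⟩ := A.exists_mul_rpow_le hA 1
    obtain ⟨lam, hlam0, hlam, hmod⟩ := exists_modular_le_one_of_luxNorm_lt hX
    have := lorentzNorm_indicator_le_s5 hp hpt hfin one_ne_zero hT hf hlam0 hlam.ne hmod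
      MeasurableSet.univ
    rw [indicator_univ] at this
    refine this.trans_lt ?_
    have : ENNReal.ofReal T ^ p.toReal * μ univ + ((1 : NNReal) : ℝ≥0∞)⁻¹ ≠ ⊤ := by
      simp only [ENNReal.coe_one, inv_one]
      finiteness
    exact ENNReal.mul_lt_top hlam (ENNReal.rpow_lt_top_of_nonneg hpi.le this)
  · intro E hE hlim
    have hμE : Tendsto (fun n => μ (E n)) atTop (𝓝 0) := by
      rw [← measure_empty (μ := μ)]
      refine tendsto_measure_of_ae_tendsto_indicator_of_isFiniteMeasure _ MeasurableSet.empty hE ?_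
      filter_upwards [hlim] with x hx
      filter_upwards [hx.eventually (gt_mem_nhds one_pos)] with n hn
      by_contra hcon
      simp_all
    refine ENNReal.tendsto_nhds_zero.2 fun ε hε => ?_
    have hg : Tendsto (fun y : ℝ≥0∞ => 2 * y ^ (p⁻¹).toReal) (𝓝 0) (𝓝 0) := by
      have h1 := (ENNReal.continuous_rpow_const (y := (p⁻¹).toReal)).tendsto 0
      rw [ENNReal.zero_rpow_of_pos hpi] at h1
      simpa using ENNReal.Tendsto.const_mul (a := 2) h1 (Or.inr ENNReal.ofNat_ne_top)
    obtain ⟨η, hη, hηle⟩ : ∃ η : ℝ≥0∞, 0 < η ∧ ∀ y < η, 2 * y ^ (p⁻¹).toReal < ε := by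
      obtain ⟨η, hη, h⟩ := ENNReal.nhds_zero_basis.eventually_iff.1 (hg.eventually (gt_mem_nhds hε))
      exact ⟨η, hη, fun y hy => h hy⟩
    obtain ⟨n, hn⟩ := ENNReal.exists_inv_nat_lt hη.ne'
    have hK0 : (n : NNReal) ≠ 0 := by
      rintro h0
      have : n = 0 := by exact_mod_cast h0
      simp [this] at hn
    obtain ⟨T, hT⟩ := A.exists_mul_rpow_le hA (n : NNReal)
    have hev : Tendsto (fun k => ENNReal.ofReal T ^ p.toReal * μ (E k) + ((n : NNReal) : ℝ≥0∞)⁻¹)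
        atTop (𝓝 ((n : NNReal) : ℝ≥0∞)⁻¹) := by
      have h1 := ENNReal.Tendsto.const_mul (a := ENNReal.ofReal T ^ p.toReal) hμE
        (Or.inr (by finiteness))
      simpa using h1.add_const ((n : NNReal) : ℝ≥0∞)⁻¹
    filter_upwards [hev.eventually (gt_mem_nhds (by simpa using hn))] with k hk
    refine iSup_le fun f => ?_
    obtain ⟨lam, hlam0, hlam, hmod⟩ := exists_modular_le_one_of_luxNorm_lt
      (f.2.2.trans_lt ENNReal.one_lt_two)
    calc lorentzNorm μ p p ((E k).indicator f.1)
        ≤ lam * (ENNReal.ofReal T ^ p.toReal * μ (E k) + ((n : NNReal) : ℝ≥0∞)⁻¹) ^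
            (p⁻¹).toReal :=
          lorentzNorm_indicator_le_s5 hp hpt hfin hK0 hT f.2.1 hlam0
            (hlam.trans ENNReal.ofNat_lt_top).ne hmod (hE k)
      _ ≤ 2 * (ENNReal.ofReal T ^ p.toReal * μ (E k) + ((n : NNReal) : ℝ≥0∞)⁻¹) ^
            (p⁻¹).toReal := by gcongr
      _ ≤ ε := (hηle _ hk).le

end Lorentz


/-- On a non-atomic finite measure space of positive measure,
for a Young function `A` and `1 ≤ p ≤ q ≤ ∞`, the following are equivalent:
(a) `L^A ↪* L^p`; (b) `L^A ↪* L^{p,q}`; (c) `p < ∞` and `lim_{t→∞} A(t)/t^p = ∞`. -/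
theorem orlicz_lorentz_almost_compact_nonconvex
    {R : Type*} [MeasurableSpace R] (μ : Measure R)
    (hna : NonAtomic μ) (hpos : 0 < μ Set.univ) (hfin : μ Set.univ < ⊤)
    (A : YoungFunction) (p q : ℝ≥0∞) (hp : 1 ≤ p) (hpq : p ≤ q) :
    (AlmostCompactEmbedding μ (luxNorm μ A) (lorentzNorm μ p p) ↔
      AlmostCompactEmbedding μ (luxNorm μ A) (lorentzNorm μ p q)) ∧
    (AlmostCompactEmbedding μ (luxNorm μ A) (lorentzNorm μ p q) ↔
      (p ≠ ⊤ ∧ Filter.Tendsto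
        (fun t : ℝ => A.toFun (ENNReal.ofReal t) / ENNReal.ofReal t ^ p.toReal)
        Filter.atTop (nhds ⊤))) := by
  have hq : 1 ≤ q := hp.trans hpq
  rcases eq_or_ne p ⊤ with rfl | hpt
  · obtain rfl : q = ⊤ := top_le_iff.1 hpq
    exact ⟨Iff.rfl, fun h => absurd h (not_almostCompactEmbedding_top hna hpos hfin A hq),
      fun h => absurd rfl h.1⟩
  have hab : AlmostCompactEmbedding μ (luxNorm μ A) (lorentzNorm μ p p) →
      AlmostCompactEmbedding μ (luxNorm μ A) (lorentzNorm μ p q) := fun h =>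
    h.mono_right (lorentzNorm_le_lorentzNorm_self hp hpt hpq)
  have hbc := fun h : AlmostCompactEmbedding μ (luxNorm μ A) (lorentzNorm μ p q) =>
    h.tendsto_young_div_rpow hna hpos hfin hp hpt hq
  have hca := almostCompactEmbedding_of_tendsto (μ := μ) hfin (A := A) hp hpt
  exact ⟨⟨hab, fun h => hca (hbc h)⟩, fun h => ⟨hpt, hbc h⟩, fun h => hab (hca h.2)⟩
end
end
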